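/- Unconditional energy stability of the second-order BDF2 IEQ scheme: let ε ∈ ℝ, δt > 0, B ∈ ℝ, let F : ℝ → ℝ be continuously differentiable with F(s) + B > 0 for all s, set H(s) = F'(s)/√(F(s)+B), and let M : ℝ → ℝ be continuously differentiable with M(s) ≥ 0 for all s. Suppose φ^{n−1}, φⁿ, φ^{n+1}, μ, U^{n−1}, Uⁿ, U^{n+1} : ℝᵈ → ℝ are smooth ℤᵈ-periodic functions and, with φ* = 2φⁿ − φ^{n−1}, they satisfy pointwise on ℝᵈ: (3φ^{n+1} − 4φⁿ + φ^{n−1})/(2δt) = div(M(φ*)∇μ), μ = −ε²Δφ^{n+1} + U^{n+1}·H(φ*), and 2(3U^{n+1} − 4Uⁿ + U^{n−1}) = H(φ*)(3φ^{n+1} − 4φⁿ + φ^{n−1}). Then, with E(φ,ψ,U,V) = (ε²/4)(‖∇φ‖² + ‖2∇φ − ∇ψ‖²) + (1/2)(‖U‖² + ‖2U − V‖²) − B where ‖g‖² = ∫_Q |g(x)|² dx, one has (1/δt)(E(φ^{n+1},φⁿ,U^{n+1},Uⁿ) − E(φⁿ,φ^{n−1},Uⁿ,U^{n−1})) ≤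 −∫_Q M(φ*(x)) |∇μ(x)|² dx ≤ 0. -/

import Mathlib

open MeasureTheory Real

noncomputable section

/-- `ℝᵈ` as a Euclidean space. -/
abbrev Esp (d : ℕ) := EuclideanSpace ℝ (Fin d)

/-- The unit cell `Q = [0,1]^d`. -/
def unitCube (d : ℕ) : Set (Esp d) := {x | ∀ i, 0 ≤ x i ∧ x i ≤ 1}

/-- `ℤᵈ`-periodicity of a (scalar- or vector-valued) function on `ℝᵈ`. -/
def ZPer {d : ℕ} {α : Type*} (g : Esp d → α) : Prop :=
  ∀ (x : Esp d) (k : Fin d → ℤ),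
    g (x + (WithLp.equiv 2 (Fin d → ℝ)).symm (fun i => (k i : ℝ))) = g x

/-- Divergence of a vector field on `ℝᵈ`. -/
def pdiv {d : ℕ} (F : Esp d → Esp d) (x : Esp d) : ℝ :=
  ∑ i, fderiv ℝ (fun y => F y i) x (EuclideanSpace.single i 1)

/-- Laplacian of a scalar field on `ℝᵈ`. -/
def plap {d : ℕ} (f : Esp d → ℝ) (x : Esp d) : ℝ := pdiv (gradient f) x

open scoped RealInnerProductSpace

lemma unitCube_eq_preimage (d : ℕ) :
    unitCube d = (WithLp.ofLp : Esp d → Fin d → ℝ) ⁻¹' Set.Icc 0 1 := by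
  ext x
  simp only [unitCube, Set.mem_ofPred_eq, Set.mem_preimage, Set.mem_Icc, Pi.le_def, Pi.zero_apply,
    Pi.one_apply, forall_and]

lemma isCompact_unitCube (d : ℕ) : IsCompact (unitCube d) := by
  have h : unitCube d = (WithLp.toLp 2 : (Fin d → ℝ) → Esp d) '' Set.Icc 0 1 := by
    rw [unitCube_eq_preimage]
    ext x
    constructor
    · intro hx
      exact ⟨WithLp.ofLp x, hx, rfl⟩
    · rintro ⟨y, hy, rfl⟩
      exact hy
  rw [h]
  exact isCompact_Icc.image (PiLp.continuous_toLp 2 _)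

lemma Continuous.integrableOn_unitCube {d : ℕ} {E : Type*} [NormedAddCommGroup E]
    {f : Esp d → E} (hf : Continuous f) : IntegrableOn f (unitCube d) :=
  hf.continuousOn.integrableOn_compact (isCompact_unitCube d)

lemma ContDiff.gradient_of_add_one_le {d : ℕ} {f : Esp d → ℝ} {m n : WithTop ℕ∞}
    (hf : ContDiff ℝ n f) (hmn : m + 1 ≤ n) : ContDiff ℝ m (gradient f) :=
  (InnerProductSpace.toDual ℝ (Esp d)).symm.contDiff.comp (hf.fderiv_right hmn)

lemma ZPer.gradient {d : ℕ} {f : Esp d → ℝ} (hf : ZPer f) : ZPer (gradient f) := by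
  intro x k
  have h : (fun y => f (y + (WithLp.equiv 2 (Fin d → ℝ)).symm (fun i => (k i : ℝ)))) = f :=
    funext fun y => hf y k
  simp only [_root_.gradient]
  rw [← fderiv_comp_add_right, h]

lemma continuous_pdiv {d : ℕ} {G : Esp d → Esp d} (hG : ContDiff ℝ 1 G) :
    Continuous (pdiv G) := by
  refine continuous_finsetSum _ fun i _ => ?_
  exact ((contDiff_euclidean.1 hG i).continuous_fderiv one_ne_zero).clm_apply continuous_const

lemma pdiv_smul {d : ℕ} {f : Esp d → ℝ} {G : Esp d → Esp d} {x : Esp d}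
    (hf : DifferentiableAt ℝ f x) (hG : DifferentiableAt ℝ G x) :
    pdiv (fun y => f y • G y) x = f x * pdiv G x + ⟪gradient f x, G x⟫ := by
  have hGi : ∀ i, DifferentiableAt ℝ (fun y => G y i) x := differentiableAt_euclidean.1 hG
  have hi : ∀ i, gradient f x i = fderiv ℝ f x (EuclideanSpace.single i 1) := fun i => by
    rw [← InnerProductSpace.toDual_symm_apply (𝕜 := ℝ), EuclideanSpace.inner_single_right]
    simp [gradient]
  simp only [pdiv, PiLp.smul_apply, smul_eq_mul, PiLp.inner_apply, Finset.mul_sum]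
  rw [← Finset.sum_add_distrib]
  refine Finset.sum_congr rfl fun i _ => ?_
  rw [fderiv_fun_mul hf (hGi i), hi]
  simp

/-- The divergence of a periodic `C¹` vector field integrates to zero over the unit cell. -/
lemma integral_pdiv_eq_zero {d : ℕ} {G : Esp d → Esp d} (hG : ContDiff ℝ 1 G) (hp : ZPer G) :
    ∫ x in unitCube d, pdiv G x = 0 := by
  cases d with
  | zero => simp [pdiv]
  | succ n =>
    have hmp := PiLp.volume_preserving_toLp (Fin (n + 1))
    have hme : MeasurableEmbedding (WithLp.toLp 2 : (Fin (n + 1) → ℝ) → Esp (n + 1)) :=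
      (MeasurableEquiv.toLp 2 (Fin (n + 1) → ℝ)).measurableEmbedding
    rw [← hmp.setIntegral_preimage_emb hme]
    have hpre : (WithLp.toLp 2 : (Fin (n + 1) → ℝ) → Esp (n + 1)) ⁻¹' unitCube (n + 1)
        = Set.Icc 0 1 := by
      rw [unitCube_eq_preimage]
      rfl
    rw [hpre]
    let e : (Fin (n + 1) → ℝ) →L[ℝ] Esp (n + 1) :=
      (PiLp.continuousLinearEquiv 2 ℝ (fun _ : Fin (n + 1) => ℝ)).symm
    have hd : ∀ i y, HasFDerivAt (fun z : Fin (n + 1) → ℝ => G (WithLp.toLp 2 z) i)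
        ((fderiv ℝ (fun w => G w i) (WithLp.toLp 2 y)).comp e) y := fun i y =>
      HasFDerivAt.comp (f := e) y
        (((contDiff_euclidean.1 hG i).differentiable one_ne_zero _).hasFDerivAt) e.hasFDerivAt
    have key := integral_divergence_of_hasFDerivAt_off_countable'
      (E := ℝ) (n := n) (a := 0) (b := 1) zero_le_one
      (fun i y => G (WithLp.toLp 2 y) i)
      (fun i y => (fderiv ℝ (fun w => G w i) (WithLp.toLp 2 y)).comp e)
      ∅ Set.countable_empty
      (fun i y _ => (hd i y).continuousAt.continuousWithinAt)
      (fun y _ i => hd i y)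
      (Continuous.integrableOn_Icc
        ((continuous_pdiv hG).comp (PiLp.continuous_toLp 2 (fun _ : Fin (n + 1) => ℝ))))
    refine Eq.trans key (Finset.sum_eq_zero fun i _ => ?_)
    rw [sub_eq_zero]
    refine integral_congr_ae (Filter.Eventually.of_forall fun y => ?_)
    have hper := hp (WithLp.toLp 2 (i.insertNth (0 : ℝ) y)) (Pi.single i 1)
    have hshift : WithLp.toLp 2 (i.insertNth (0 : ℝ) y)
        + (WithLp.equiv 2 (Fin (n + 1) → ℝ)).symm
          (fun j => ((Pi.single i 1 : Fin (n + 1) → ℤ) j : ℝ))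
        = (WithLp.toLp 2 (i.insertNth (1 : ℝ) y) : Esp (n + 1)) := by
      ext j
      refine Fin.succAboveCases i ?_ (fun k => ?_) j <;> simp
    rw [hshift] at hper
    exact congrArg (fun v : Esp (n + 1) => v i) hper

/-- Integration by parts for periodic functions on the unit cell. -/
lemma integral_mul_pdiv {d : ℕ} {f : Esp d → ℝ} {G : Esp d → Esp d}
    (hf : ContDiff ℝ 1 f) (hG : ContDiff ℝ 1 G) (hpf : ZPer f) (hpG : ZPer G) :
    ∫ x in unitCube d, f x * pdiv G x = -∫ x in unitCube d, ⟪gradient f x, G x⟫ := by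
  have h := integral_pdiv_eq_zero (hf.smul hG) (fun x k => congrArg₂ (· • ·) (hpf x k) (hpG x k))
  have hpt : ∀ x, pdiv (f • G) x = f x * pdiv G x + ⟪gradient f x, G x⟫ := fun x =>
    pdiv_smul (hf.differentiable one_ne_zero x) (hG.differentiable one_ne_zero x)
  rw [integral_congr_ae (Filter.Eventually.of_forall hpt), integral_add] at h
  · linarith
  · exact (hf.continuous.mul (continuous_pdiv hG)).integrableOn_unitCube
  · exact ((hf.gradient_of_add_one_le (m := 0) (by simp)).continuous.inner
      hG.continuous).integrableOn_unitCube

/-- The BDF2 polarization inequality, in the form of a lower bound for `2⟨a, 3a - 4b + c⟩`. -/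
lemma bdf2_inner_lower_bound {V : Type*} [NormedAddCommGroup V] [InnerProductSpace ℝ V]
    (a b c : V) :
    (‖a‖ ^ 2 + ‖(2 : ℝ) • a - b‖ ^ 2) - (‖b‖ ^ 2 + ‖(2 : ℝ) • b - c‖ ^ 2)
      ≤ 2 * ⟪a, (3 : ℝ) • a - (4 : ℝ) • b + c⟫ := by
  have h : 0 ≤ ‖a - (2 : ℝ) • b + c‖ ^ 2 := sq_nonneg _
  simp only [← real_inner_self_eq_norm_sq, inner_add_left, inner_add_right, inner_sub_left,
    inner_sub_right, real_inner_smul_left, real_inner_smul_right] at h ⊢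
  rw [real_inner_comm a b, real_inner_comm a c, real_inner_comm b c] at *
  linarith

lemma gradient_bdf2 {d : ℕ} {a b c : Esp d → ℝ} {x : Esp d} (ha : DifferentiableAt ℝ a x)
    (hb : DifferentiableAt ℝ b x) (hc : DifferentiableAt ℝ c x) :
    gradient (fun y => 3 * a y - 4 * b y + c y) x
      = (3 : ℝ) • gradient a x - (4 : ℝ) • gradient b x + gradient c x := by
  have h : HasFDerivAt (fun y => 3 * a y - 4 * b y + c y)
      ((3 : ℝ) • fderiv ℝ a x - (4 : ℝ) • fderiv ℝ b x + fderiv ℝ c x) x :=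
    ((ha.hasFDerivAt.const_mul 3).sub (hb.hasFDerivAt.const_mul 4)).add hc.hasFDerivAt
  simp only [gradient]
  rw [h.fderiv]
  simp

/-- Unconditional energy stability of the second-order BDF2 IEQ scheme. -/
theorem bdf2_ieq_energy_stability (d : ℕ) (hd : 1 ≤ d)
    (ε δt B : ℝ) (hδt : 0 < δt)
    (F : ℝ → ℝ) (hF : ContDiff ℝ 1 F) (hFB : ∀ s : ℝ, 0 < F s + B)
    (H : ℝ → ℝ) (hH : ∀ s : ℝ, H s = deriv F s / Real.sqrt (F s + B))
    (M : ℝ → ℝ) (hM : ContDiff ℝ 1 M) (hM0 : ∀ s : ℝ, 0 ≤ M s)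
    (φm φ0 φ1 μ Um U0 U1 : Esp d → ℝ)
    (hφm : ContDiff ℝ (⊤ : ℕ∞) φm) (hφ0 : ContDiff ℝ (⊤ : ℕ∞) φ0) (hφ1 : ContDiff ℝ (⊤ : ℕ∞) φ1)
    (hμ : ContDiff ℝ (⊤ : ℕ∞) μ)
    (hUm : ContDiff ℝ (⊤ : ℕ∞) Um) (hU0 : ContDiff ℝ (⊤ : ℕ∞) U0) (hU1 : ContDiff ℝ (⊤ : ℕ∞) U1)
    (hpφm : ZPer φm) (hpφ0 : ZPer φ0) (hpφ1 : ZPer φ1) (hpμ : ZPer μ)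
    (hpUm : ZPer Um) (hpU0 : ZPer U0) (hpU1 : ZPer U1)
    (φs : Esp d → ℝ) (hφs : ∀ x : Esp d, φs x = 2 * φ0 x - φm x)
    (heq1 : ∀ x : Esp d,
      (3 * φ1 x - 4 * φ0 x + φm x) / (2 * δt)
        = pdiv (fun y => M (φs y) • gradient μ y) x)
    (heq2 : ∀ x : Esp d, μ x = -ε ^ 2 * plap φ1 x + U1 x * H (φs x))
    (heq3 : ∀ x : Esp d,
      2 * (3 * U1 x - 4 * U0 x + Um x) = H (φs x) * (3 * φ1 x - 4 * φ0 x + φm x))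
    (E : (Esp d → ℝ) → (Esp d → ℝ) → (Esp d → ℝ) → (Esp d → ℝ) → ℝ)
    (hE : ∀ φ ψ U V : Esp d → ℝ, E φ ψ U V =
      ε ^ 2 / 4 * ((∫ x in unitCube d, ‖gradient φ x‖ ^ 2)
          + ∫ x in unitCube d, ‖(2 : ℝ) • gradient φ x - gradient ψ x‖ ^ 2)
        + 1 / 2 * ((∫ x in unitCube d, (U x) ^ 2)
          + ∫ x in unitCube d, (2 * U x - V x) ^ 2) - B) :
    (1 / δt) * (E φ1 φ0 U1 U0 - E φ0 φm U0 Um)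
        ≤ -∫ x in unitCube d, M (φs x) * ‖gradient μ x‖ ^ 2
      ∧ (-∫ x in unitCube d, M (φs x) * ‖gradient μ x‖ ^ 2) ≤ 0 := by
  have hnonneg : 0 ≤ ∫ x in unitCube d, M (φs x) * ‖gradient μ x‖ ^ 2 :=
    integral_nonneg fun x => mul_nonneg (hM0 _) (sq_nonneg _)
  refine ⟨?_, neg_nonpos.2 hnonneg⟩
  have h2 : (2 : WithTop ℕ∞) ≤ ((⊤ : ℕ∞) : WithTop ℕ∞) := WithTop.coe_le_coe.2 le_top
  have h1 : (1 : WithTop ℕ∞) ≤ ((⊤ : ℕ∞) : WithTop ℕ∞) := WithTop.coe_le_coe.2 le_top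
  have hgrad : ∀ f : Esp d → ℝ, ContDiff ℝ (⊤ : ℕ∞) f → ContDiff ℝ 1 (gradient f) := fun f hf =>
    hf.gradient_of_add_one_le (by rw [one_add_one_eq_two]; exact h2)
  have gm := (hgrad _ hφm).continuous
  have g0 := (hgrad _ hφ0).continuous
  have g1 := (hgrad _ hφ1).continuous
  have cm := hUm.continuous
  have c0 := hU0.continuous
  have c1 := hU1.continuous
  set D : Esp d → ℝ := fun x => 3 * φ1 x - 4 * φ0 x + φm x with hD
  have hDc : ContDiff ℝ 1 D :=
    ((contDiff_const.mul (hφ1.of_le h1)).sub (contDiff_const.mul (hφ0.of_le h1))).add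
      (hφm.of_le h1)
  have hDp : ZPer D := fun x k => by simp only [hD, hpφ1 x k, hpφ0 x k, hpφm x k]
  have hgD : ∀ x, gradient D x
      = (3 : ℝ) • gradient φ1 x - (4 : ℝ) • gradient φ0 x + gradient φm x := fun x =>
    gradient_bdf2 ((hφ1.of_le h1).differentiable one_ne_zero x)
      ((hφ0.of_le h1).differentiable one_ne_zero x) ((hφm.of_le h1).differentiable one_ne_zero x)
  have hgDc : Continuous (gradient D) :=
    (hDc.gradient_of_add_one_le (m := 0) (by simp)).continuous
  have hφs' : φs = fun x => 2 * φ0 x - φm x := funext hφs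
  have hφsc : ContDiff ℝ 1 φs := by
    rw [hφs']
    exact (contDiff_const.mul (hφ0.of_le h1)).sub (hφm.of_le h1)
  have hJ : ContDiff ℝ 1 (fun y => M (φs y) • gradient μ y) := (hM.comp hφsc).smul (hgrad _ hμ)
  have hJp : ZPer (fun y => M (φs y) • gradient μ y) := fun x k => by
    simp only [hφs, hpφ0 x k, hpφm x k, hpμ.gradient x k]
  have hdiss : ∫ x in unitCube d, μ x * D x
      = -(2 * δt * ∫ x in unitCube d, M (φs x) * ‖gradient μ x‖ ^ 2) := by
    have hibp := integral_mul_pdiv (hμ.of_le h1) hJ hpμ hJp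
    simp only [real_inner_smul_right, real_inner_self_eq_norm_sq] at hibp
    rw [neg_mul_eq_mul_neg, ← hibp, ← integral_const_mul]
    refine integral_congr_ae (Filter.Eventually.of_forall fun x => ?_)
    have := heq1 x
    simp only [hD]
    rw [← this]
    field_simp
  have hlap := integral_mul_pdiv hDc (hgrad _ hφ1) hDp hpφ1.gradient
  have hpc : Continuous (pdiv (gradient φ1)) := continuous_pdiv (hgrad _ hφ1)
  have hweak : ∫ x in unitCube d, μ x * D x
      = ∫ x in unitCube d, (ε ^ 2 * ⟪gradient D x, gradient φ1 x⟫
          + 2 * (U1 x * (3 * U1 x - 4 * U0 x + Um x))) := by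
    have hpt : ∀ x, μ x * D x = -ε ^ 2 * (D x * pdiv (gradient φ1) x)
        + 2 * (U1 x * (3 * U1 x - 4 * U0 x + Um x)) := fun x => by
      have e2 := heq2 x
      have e3 := heq3 x
      simp only [plap] at e2
      simp only [hD]
      rw [e2]
      linear_combination -(U1 x) * e3
    simp only [hpt]
    rw [integral_add, integral_add, integral_const_mul, integral_const_mul,
      integral_const_mul, hlap]
    · ring
    all_goals
      refine Continuous.integrableOn_unitCube ?_
      have := hDc.continuous
      fun_prop
  have henergy : 2 * (E φ1 φ0 U1 U0 - E φ0 φm U0 Um) ≤ ∫ x in unitCube d, μ x * D x := by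
    have hEint : ∀ φ ψ U V : Esp d → ℝ, Continuous (gradient φ) → Continuous (gradient ψ) →
        Continuous U → Continuous V → E φ ψ U V = (∫ x in unitCube d,
          (ε ^ 2 / 4 * (‖gradient φ x‖ ^ 2 + ‖(2 : ℝ) • gradient φ x - gradient ψ x‖ ^ 2)
          + 1 / 2 * ((U x) ^ 2 + (2 * U x - V x) ^ 2))) - B := by
      intro φ ψ U V hφ hψ hU hV
      rw [hE, integral_add, integral_const_mul, integral_const_mul, integral_add, integral_add]
      all_goals
        refine Continuous.integrableOn_unitCube ?_
        fun_prop
    rw [hEint _ _ _ _ g1 g0 c1 c0, hEint _ _ _ _ g0 gm c0 cm, sub_sub_sub_cancel_right,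
      ← integral_sub, ← integral_const_mul, hweak]
    · refine integral_mono ?_ ?_ fun x => ?_
      · exact Continuous.integrableOn_unitCube (by fun_prop)
      · exact Continuous.integrableOn_unitCube (by fun_prop)
      · have hg := mul_le_mul_of_nonneg_left
          (bdf2_inner_lower_bound (gradient φ1 x) (gradient φ0 x) (gradient φm x)) (sq_nonneg ε)
        simp only [hgD]
        rw [real_inner_comm]
        nlinarith [sq_nonneg (U1 x - 2 * U0 x + Um x)]
    all_goals exact Continuous.integrableOn_unitCube (by fun_prop)
  rw [hdiss] at henergy
  rw [one_div, inv_mul_le_iff₀ hδt]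
  linarith
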